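/- In the noisy sampling model, the AddS3 similarity s_{ij} computed from the noisy random triplet set T' satisfies E[s_{ij}] = (1−2δ)·p·s_{0ij} for every pair i<j, where s_{0ij} is the AddS3 similarity computed from the full induced triplet set T0; moreover, for any α > 0, if p > (α+2)·log n / n, then with probability at least 1 − n^{−α}, max_{1≤i<j≤n} |s_{ij} − (1−2δ)·p·s_{0ij}| < 4·√((α+2)·p·n·log n). -/

import Mathlib

open Finset MeasureTheory

namespace CompHC

/-- A rooted binary tree with leaves labelled by elements of `Fin n`. -/
inductive HTree (n : ℕ) : Type
  | leaf (i : Fin n) : HTree n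
  | node (l r : HTree n) : HTree n

namespace HTree

/-- The list of leaf labels of a tree. -/
def leaves {n : ℕ} : HTree n → List (Fin n)
  | .leaf i => [i]
  | .node l r => l.leaves ++ r.leaves

/-- The number of leaves of a tree. -/
def size {n : ℕ} (t : HTree n) : ℕ := t.leaves.length

/-- `|H(i ∨ j)|`: the number of leaves of the smallest subtree containing both `i` and `j`. -/
def lcaSize {n : ℕ} : HTree n → Fin n → Fin n → ℕ
  | .leaf _, _, _ => 1
  | .node l r, i, j =>
      if i ∈ l.leaves ∧ j ∈ l.leaves then l.lcaSize i j
      else if i ∈ r.leaves ∧ j ∈ r.leaves then r.lcaSize i j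
      else l.size + r.size

/-- Sum of `f |N1| |N2|` over the internal nodes `N` of the tree, `N1, N2` its children. -/
def internalSum {n : ℕ} (f : ℕ → ℕ → ℕ) : HTree n → ℕ
  | .leaf _ => 0
  | .node l r => f l.size r.size + l.internalSum f + r.internalSum f

end HTree

/-- A hierarchy on `[n]`: every object appears exactly once as a leaf. -/
def IsHierarchy {n : ℕ} (t : HTree n) : Prop :=
  t.leaves.Nodup ∧ ∀ i : Fin n, i ∈ t.leaves

abbrev Triplet (n : ℕ) := Fin n × Fin n × Fin n
abbrev Quadruplet (n : ℕ) := Fin n × Fin n × Fin n × Fin n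

/-- The entries of a triplet are pairwise distinct. -/
def distinctTriplet {n : ℕ} (t : Triplet n) : Prop :=
  t.1 ≠ t.2.1 ∧ t.1 ≠ t.2.2 ∧ t.2.1 ≠ t.2.2

/-- A quadruplet `(i,j,k,l)` satisfies `i<j`, `k<l`, `(i,j) ≠ (k,l)`. -/
def validQuadruplet {n : ℕ} (q : Quadruplet n) : Prop :=
  q.1 < q.2.1 ∧ q.2.2.1 < q.2.2.2 ∧ (q.1, q.2.1) ≠ (q.2.2.1, q.2.2.2)

/-- Triplet revenue `Trev(H,T) = Σ_{(i,j,k)∈T} (|H(i∨k)| − |H(i∨j)|)`. -/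
def Trev {n : ℕ} (H : HTree n) (T : Finset (Triplet n)) : ℤ :=
  ∑ t ∈ T, ((H.lcaSize t.1 t.2.2 : ℤ) - (H.lcaSize t.1 t.2.1 : ℤ))

/-- Quadruplet revenue `Qrev(H,Q) = Σ_{(i,j,k,l)∈Q} (|H(k∨l)| − |H(i∨j)|)`. -/
def Qrev {n : ℕ} (H : HTree n) (Q : Finset (Quadruplet n)) : ℤ :=
  ∑ q ∈ Q, ((H.lcaSize q.2.2.1 q.2.2.2 : ℤ) - (H.lcaSize q.1 q.2.1 : ℤ))

/-- The set of pairs `(i,j)` with `i < j`. -/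
def pairs (n : ℕ) : Finset (Fin n × Fin n) :=
  Finset.univ.filter fun p => p.1 < p.2

/-- Dasgupta's cost `Dcost(H,s) = Σ_{i<j} s_{ij}·|H(i∨j)|`. -/
noncomputable def Dcost {n : ℕ} (H : HTree n) (s : Fin n → Fin n → ℝ) : ℝ :=
  ∑ p ∈ pairs n, s p.1 p.2 * (H.lcaSize p.1 p.2 : ℝ)

/-- The AddS3 similarity computed from a triplet set. -/
def sAddS3 {n : ℕ} (T : Finset (Triplet n)) (i j : Fin n) : ℤ :=
  ∑ k ∈ Finset.univ.filter (fun k : Fin n => k ≠ i ∧ k ≠ j),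
    (((if (i, j, k) ∈ T then 1 else 0) - (if (i, k, j) ∈ T then 1 else 0)
      + (if (j, i, k) ∈ T then 1 else 0) - (if (j, k, i) ∈ T then 1 else 0) : ℤ))

/-- The AddS4 similarity computed from a quadruplet set. -/
def sAddS4 {n : ℕ} (Q : Finset (Quadruplet n)) (i j : Fin n) : ℤ :=
  ∑ p ∈ (pairs n).filter (fun p => p ≠ (i, j)),
    (((if (i, j, p.1, p.2) ∈ Q then 1 else 0)
      - (if (p.1, p.2, i, j) ∈ Q then 1 else 0) : ℤ))

/-- The triplet set induced by a hierarchy `H0`: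
`T0 = {(i,j,k) : i,j,k pairwise distinct, |H0(i∨j)| < min(|H0(i∨k)|, |H0(j∨k)|)}`. -/
def inducedTriplets {n : ℕ} (H : HTree n) : Finset (Triplet n) :=
  Finset.univ.filter fun t : Triplet n =>
    t.1 ≠ t.2.1 ∧ t.1 ≠ t.2.2 ∧ t.2.1 ≠ t.2.2 ∧
    H.lcaSize t.1 t.2.1 < min (H.lcaSize t.1 t.2.2) (H.lcaSize t.2.1 t.2.2)


/-- Bernoulli measure on `Bool` with success probability `p`. -/
noncomputable def bern (p : ℝ) : Measure Bool :=
  (ENNReal.ofReal p) • Measure.dirac true + (ENNReal.ofReal (1 - p)) • Measure.dirac false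

/-- Product measure of i.i.d. Bernoulli(p) coins, one for each pair of triplets
`{(i,j,k),(j,i,k)}` (indexed by triplets; only keys `(i,j,k)` with `i ≤ j` are used). -/
noncomputable def sampleMeasure (n : ℕ) (p : ℝ) : Measure (Triplet n → Bool) :=
  Measure.pi fun _ => bern p

/-- The common key of the pair of triplets `{(i,j,k),(j,i,k)}`. -/
def pairKey {n : ℕ} (t : Triplet n) : Triplet n := (min t.1 t.2.1, max t.1 t.2.1, t.2.2)

/-- The random subset `T ⊆ T0`: the pair `{(i,j,k),(j,i,k)}` is included iff its coin is true. -/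
def sampledT {n : ℕ} (H0 : HTree n) (ω : Triplet n → Bool) : Finset (Triplet n) :=
  (inducedTriplets H0).filter fun t => ω (pairKey t) = true

/-- The key of the flipping coin `ζ^i_{jk}` for the triplets `(i,j,k)` and `(i,k,j)`. -/
def flipKey {n : ℕ} (t : Triplet n) : Triplet n := (t.1, min t.2.1 t.2.2, max t.2.1 t.2.2)

/-- Flipping a triplet: `(i,j,k) ↦ (i,k,j)`. -/
def flipTriplet {n : ℕ} (t : Triplet n) : Triplet n := (t.1, t.2.2, t.2.1)

/-- Product measure: independent Bernoulli(p) sampling coins (left index) and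
Bernoulli(δ) flipping coins (right index). -/
noncomputable def noisyMeasure (n : ℕ) (p δ : ℝ) :
    Measure ((Triplet n ⊕ Triplet n) → Bool) :=
  Measure.pi fun idx => Sum.elim (fun _ : Triplet n => bern p) (fun _ : Triplet n => bern δ) idx

/-- The noisy random triplet set `T'`: sample pairs from `T0` with probability `p`, then flip
each sampled triplet `(i,j,k)` to `(i,k,j)` independently with probability `δ`. -/
def noisySampledT {n : ℕ} (H0 : HTree n) (ω : (Triplet n ⊕ Triplet n) → Bool) :
    Finset (Triplet n) :=
  ((inducedTriplets H0).filter fun t => ω (Sum.inl (pairKey t)) = true).image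
    fun t => if ω (Sum.inr (flipKey t)) = true then flipTriplet t else t

open ProbabilityTheory

section CoinFlips

variable {ι : Type*} [Fintype ι] {μ : ι → Measure Bool} [∀ i, IsProbabilityMeasure (μ i)]

/-- Functions of disjoint sets of independent coins are independent. -/
lemma indepFun_of_dependsOn {β γ : Type*} [Nonempty β] [Nonempty γ] [MeasurableSpace β]
    [MeasurableSpace γ] {S T : Set ι} (hST : Disjoint S T) {f : (ι → Bool) → β}
    {g : (ι → Bool) → γ} (hf : DependsOn f S) (hg : DependsOn g T) :
    IndepFun f g (Measure.pi μ) := by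
  classical
  obtain ⟨S, rfl⟩ : ∃ S' : Finset ι, (S' : Set ι) = S := ⟨S.toFinite.toFinset, by simp⟩
  obtain ⟨T, rfl⟩ : ∃ T' : Finset ι, (T' : Set ι) = T := ⟨T.toFinite.toFinset, by simp⟩
  obtain ⟨f', rfl⟩ := dependsOn_iff_exists_comp.1 hf
  obtain ⟨g', rfl⟩ := dependsOn_iff_exists_comp.1 hg
  have h : iIndepFun (fun (i : ι) (ω : ι → Bool) ↦ ω i) (Measure.pi μ) :=
    iIndepFun_pi (X := fun _ ↦ id) fun _ ↦ aemeasurable_id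
  exact (h.indepFun_finset S T (Finset.disjoint_coe.1 hST) fun i ↦ measurable_pi_apply i).comp
    (φ := f') (ψ := g') Measurable.of_discrete Measurable.of_discrete

lemma mgf_sum_of_dependsOn {κ : Type*} {S : κ → Set ι} {X : κ → (ι → Bool) → ℝ} {s : Finset κ}
    (hS : (s : Set κ).PairwiseDisjoint S) (hX : ∀ k ∈ s, DependsOn (X k) (S k)) (t : ℝ) :
    mgf (∑ k ∈ s, X k) (Measure.pi μ) t = ∏ k ∈ s, mgf (X k) (Measure.pi μ) t := by
  classical
  induction s using Finset.induction_on with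
  | empty => simp
  | insert a s ha ih =>
    have hdep : DependsOn (∑ k ∈ s, X k) (⋃ k ∈ s, S k) := by
      intro x y hxy
      simp only [Finset.sum_apply]
      refine Finset.sum_congr rfl fun k hk ↦ hX k (Finset.mem_insert_of_mem hk) fun i hi ↦ ?_
      exact hxy i (Set.mem_biUnion (Finset.mem_coe.2 hk) hi)
    have hdisj : Disjoint (S a) (⋃ k ∈ s, S k) := by
      refine Set.disjoint_iUnion₂_right.2 fun k hk ↦ hS (by simp) (by simp [hk]) ?_
      rintro rfl
      exact ha hk
    have hind : IndepFun (X a) (∑ k ∈ s, X k) (Measure.pi μ) :=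
      indepFun_of_dependsOn hdisj (hX a (by simp)) hdep
    rw [Finset.sum_insert ha, Finset.prod_insert ha,
      hind.mgf_add Measurable.of_discrete.aestronglyMeasurable
        Measurable.of_discrete.aestronglyMeasurable,
      ih (hS.subset (by simp)) fun k hk ↦ hX k (Finset.mem_insert_of_mem hk)]

end CoinFlips

lemma mgf_le_exp_of_abs_le {Ω : Type*} [MeasurableSpace Ω] {μ : Measure Ω}
    [IsProbabilityMeasure μ] {X : Ω → ℝ} (hX : Measurable X) {b t : ℝ} (hb : ∀ ω, |X ω| ≤ b)
    (ht : |t| * b ≤ 1) :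
    mgf X μ t ≤ Real.exp (t * ∫ ω, X ω ∂μ + t ^ 2 * ∫ ω, X ω ^ 2 ∂μ) := by
  have hint : Integrable X μ := .of_bound hX.aestronglyMeasurable b (.of_forall hb)
  have hint2 : Integrable (fun ω ↦ X ω ^ 2) μ :=
    .of_bound (hX.pow_const 2).aestronglyMeasurable (b ^ 2) (.of_forall fun ω ↦ by
      rw [Real.norm_eq_abs, abs_pow]; gcongr; exact hb ω)
  have hle : ∀ ω, |t * X ω| ≤ 1 := fun ω ↦ by
    rw [abs_mul]
    exact (mul_le_mul_of_nonneg_left (hb ω) (abs_nonneg t)).trans ht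
  calc mgf X μ t ≤ ∫ ω, (1 + t * X ω + t ^ 2 * X ω ^ 2) ∂μ := by
        refine integral_mono ?_ (((integrable_const _).add (hint.const_mul t)).add
          (hint2.const_mul _)) fun ω ↦ ?_
        · refine .of_bound (by fun_prop) (Real.exp 1) (.of_forall fun ω ↦ ?_)
          rw [Real.norm_eq_abs, Real.abs_exp]
          exact Real.exp_le_exp.2 (abs_le.1 (hle ω)).2
        · have := (abs_le.1 (Real.abs_exp_sub_one_sub_id_le (hle ω))).2
          rw [mul_pow] at this
          dsimp only
          linarith
    _ = (t * ∫ ω, X ω ∂μ + t ^ 2 * ∫ ω, X ω ^ 2 ∂μ) + 1 := by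
        rw [integral_add (f := fun ω ↦ 1 + t * X ω) ((integrable_const _).add (hint.const_mul t))
            (hint2.const_mul _), integral_add (integrable_const _) (hint.const_mul t), integral_const_mul,
          integral_const_mul]
        simp
        ring
    _ ≤ _ := Real.add_one_le_exp _

/-- A Chernoff bound for sums of bounded functions of disjoint sets of independent coins. -/
lemma measureReal_sum_ge_le {ι κ : Type*} [Fintype ι] {μ : ι → Measure Bool}
    [∀ i, IsProbabilityMeasure (μ i)] {S : κ → Set ι} {X : κ → (ι → Bool) → ℝ} {s : Finset κ}
    (hS : (s : Set κ).PairwiseDisjoint S) (hX : ∀ k ∈ s, DependsOn (X k) (S k))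
    {b v t : ℝ} (hb : ∀ k ∈ s, ∀ ω, |X k ω| ≤ b)
    (hv : ∀ k ∈ s, ∫ ω, X k ω ^ 2 ∂(Measure.pi μ) ≤ v) (ht : 0 ≤ t) (htb : t * b ≤ 1) (ε : ℝ) :
    (Measure.pi μ).real {ω | ∑ k ∈ s, ∫ ω', X k ω' ∂(Measure.pi μ) + ε ≤ ∑ k ∈ s, X k ω} ≤
      Real.exp (-t * ε + t ^ 2 * (s.card * v)) := by
  have h := measure_ge_le_exp_mul_mgf (μ := Measure.pi μ) (X := ∑ k ∈ s, X k)
    (∑ k ∈ s, ∫ ω', X k ω' ∂(Measure.pi μ) + ε) ht .of_finite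
  simp only [Finset.sum_apply] at h
  refine h.trans ?_
  have hmgf : mgf (∑ k ∈ s, X k) (Measure.pi μ) t ≤
      Real.exp (∑ k ∈ s, (t * ∫ ω, X k ω ∂(Measure.pi μ) + t ^ 2 * v)) := by
    rw [mgf_sum_of_dependsOn hS hX, Real.exp_sum]
    refine Finset.prod_le_prod (fun _ _ ↦ mgf_nonneg) fun k hk ↦ ?_
    refine (mgf_le_exp_of_abs_le Measurable.of_discrete (hb k hk)
      (by rwa [abs_of_nonneg ht])).trans ?_
    gcongr
    exact hv k hk
  refine (mul_le_mul_of_nonneg_left hmgf (Real.exp_pos _).le).trans_eq ?_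
  rw [← Real.exp_add, Finset.sum_add_distrib, ← Finset.mul_sum, Finset.sum_const, nsmul_eq_mul]
  ring_nf

lemma isProbabilityMeasure_bern {p : ℝ} (hp0 : 0 ≤ p) (hp1 : p ≤ 1) :
    IsProbabilityMeasure (bern p) := by
  refine ⟨?_⟩
  simp [bern, ← ENNReal.ofReal_add hp0 (sub_nonneg.2 hp1)]

/-- The indicator of heads. -/
def headsIndicator (b : Bool) : ℝ := if b = true then 1 else 0

lemma integral_bern {p : ℝ} (hp0 : 0 ≤ p) (hp1 : p ≤ 1) (f : Bool → ℝ) :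
    ∫ b, f b ∂(bern p) = p * f true + (1 - p) * f false := by
  rw [bern, integral_add_measure ((integrable_dirac (by simp)).smul_measure ENNReal.ofReal_ne_top)
    ((integrable_dirac (by simp)).smul_measure ENNReal.ofReal_ne_top), integral_smul_measure,
    integral_smul_measure]
  simp [ENNReal.toReal_ofReal hp0, ENNReal.toReal_ofReal (sub_nonneg.2 hp1)]

section NoisyModel

variable {n : ℕ}

lemma HTree.lcaSize_comm (H : HTree n) (i j : Fin n) : H.lcaSize i j = H.lcaSize j i := by
  induction H with
  | leaf => rfl
  | node l r hl hr => simp only [HTree.lcaSize, hl, hr, and_comm]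

/-- The indicator of membership in the triplet set induced by a hierarchy. -/
def inducedIndicator (H : HTree n) (t : Triplet n) : ℝ :=
  if t ∈ inducedTriplets H then 1 else 0

lemma inducedIndicator_swap (H : HTree n) (i j k : Fin n) :
    inducedIndicator H (j, i, k) = inducedIndicator H (i, j, k) := by
  have : (j, i, k) ∈ inducedTriplets H ↔ (i, j, k) ∈ inducedTriplets H := by
    simp only [inducedTriplets, Finset.mem_filter, Finset.mem_univ, true_and, lt_min_iff,
      H.lcaSize_comm j i]
    tauto
  simp only [inducedIndicator, this]

/-- At most one of the three objects `i, j, k` is split off first by `H`. -/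
lemma inducedIndicator_cases (H : HTree n) (i j k : Fin n) :
    (inducedIndicator H (i, k, j) = 0 ∧ inducedIndicator H (j, k, i) = 0 ∧
        (inducedIndicator H (i, j, k) = 0 ∨ inducedIndicator H (i, j, k) = 1)) ∨
      (inducedIndicator H (i, j, k) = 0 ∧ inducedIndicator H (j, k, i) = 0 ∧
        inducedIndicator H (i, k, j) = 1) ∨
      (inducedIndicator H (i, j, k) = 0 ∧ inducedIndicator H (i, k, j) = 0 ∧
        inducedIndicator H (j, k, i) = 1) := by
  have h1 := H.lcaSize_comm j i
  have h2 := H.lcaSize_comm k i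
  have h3 := H.lcaSize_comm k j
  simp only [inducedIndicator, inducedTriplets, Finset.mem_filter, Finset.mem_univ, true_and,
    lt_min_iff, h1, h2, h3]
  split_ifs <;> first | omega | simp

/-- The contribution of the object `k` to the noisy AddS3 similarity of `i` and `j`. -/
def noisyContribution (H : HTree n) (i j k : Fin n) (ω : (Triplet n ⊕ Triplet n) → Bool) : ℝ :=
  (1 - 2 * headsIndicator (ω (.inr (flipKey (i, j, k))))) *
      (inducedIndicator H (i, j, k) * headsIndicator (ω (.inl (pairKey (i, j, k)))) -
        inducedIndicator H (i, k, j) * headsIndicator (ω (.inl (pairKey (i, k, j))))) +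
    (1 - 2 * headsIndicator (ω (.inr (flipKey (j, i, k))))) *
      (inducedIndicator H (i, j, k) * headsIndicator (ω (.inl (pairKey (i, j, k)))) -
        inducedIndicator H (j, k, i) * headsIndicator (ω (.inl (pairKey (j, k, i)))))

lemma flipKey_swap (i j k : Fin n) : flipKey (i, k, j) = flipKey (i, j, k) := by
  simp [flipKey, min_comm, max_comm]

lemma pairKey_swap (i j k : Fin n) : pairKey (j, i, k) = pairKey (i, j, k) := by
  simp [pairKey, min_comm, max_comm]

lemma mem_noisySampledT (H : HTree n) (ω : (Triplet n ⊕ Triplet n) → Bool) (i j k : Fin n) :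
    (i, j, k) ∈ noisySampledT H ω ↔
      if ω (.inr (flipKey (i, j, k))) = true then
        (i, k, j) ∈ inducedTriplets H ∧ ω (.inl (pairKey (i, k, j))) = true
      else (i, j, k) ∈ inducedTriplets H ∧ ω (.inl (pairKey (i, j, k))) = true := by
  simp only [noisySampledT, Finset.mem_image, Finset.mem_filter]
  constructor
  · rintro ⟨⟨a, b, c⟩, ht, h⟩
    split_ifs at h with hf
    · obtain ⟨rfl, rfl, rfl⟩ : a = i ∧ c = j ∧ b = k := by simpa [flipTriplet] using h
      rw [flipKey_swap] at hf
      simpa [hf] using ht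
    · obtain ⟨rfl, rfl, rfl⟩ : a = i ∧ b = j ∧ c = k := by simpa using h
      simpa [hf] using ht
  · split_ifs with hf
    · exact fun h ↦ ⟨(i, k, j), h, by rw [flipKey_swap, if_pos hf]; rfl⟩
    · exact fun h ↦ ⟨(i, j, k), h, by rw [if_neg hf]⟩

lemma sAddS3_noisySampledT (H : HTree n) (ω : (Triplet n ⊕ Triplet n) → Bool) (i j : Fin n) :
    (sAddS3 (noisySampledT H ω) i j : ℝ) =
      ∑ k ∈ univ.filter (fun k : Fin n ↦ k ≠ i ∧ k ≠ j), noisyContribution H i j k ω := by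
  have key (a b c : Fin n) :
      (if (a, b, c) ∈ noisySampledT H ω then (1 : ℝ) else 0) -
          (if (a, c, b) ∈ noisySampledT H ω then (1 : ℝ) else 0) =
        (1 - 2 * headsIndicator (ω (.inr (flipKey (a, b, c))))) *
          (inducedIndicator H (a, b, c) * headsIndicator (ω (.inl (pairKey (a, b, c)))) -
            inducedIndicator H (a, c, b) * headsIndicator (ω (.inl (pairKey (a, c, b))))) := by
    simp only [mem_noisySampledT, flipKey_swap a b c, headsIndicator, inducedIndicator]
    by_cases hf : ω (.inr (flipKey (a, b, c))) = true
    · simp only [hf, if_true, ite_and]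
      split_ifs <;> norm_num
    · simp only [hf, Bool.false_eq_true, if_false, ite_and]
      split_ifs <;> norm_num
  rw [sAddS3, Int.cast_sum]
  refine Finset.sum_congr rfl fun k _ ↦ ?_
  have h1 := key i j k
  have h2 := key j i k
  rw [inducedIndicator_swap, pairKey_swap] at h2
  push_cast
  rw [noisyContribution, ← h1, ← h2]
  ring

lemma sAddS3_inducedTriplets (H : HTree n) (i j : Fin n) :
    (sAddS3 (inducedTriplets H) i j : ℝ) =
      ∑ k ∈ univ.filter (fun k : Fin n ↦ k ≠ i ∧ k ≠ j),
        (2 * inducedIndicator H (i, j, k) - inducedIndicator H (i, k, j) -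
          inducedIndicator H (j, k, i)) := by
  rw [sAddS3, Int.cast_sum]
  refine Finset.sum_congr rfl fun k _ ↦ ?_
  have h := inducedIndicator_swap H i j k
  simp only [inducedIndicator] at h ⊢
  push_cast
  linarith

lemma sAddS3_comm (T : Finset (Triplet n)) (i j : Fin n) : sAddS3 T i j = sAddS3 T j i := by
  rw [sAddS3, sAddS3]
  simp only [and_comm]
  exact Finset.sum_congr rfl fun k _ ↦ by ring

/-- The coins whose key consists of the objects `i, j, k`. -/
def coinsOn (i j k : Fin n) : Set (Triplet n ⊕ Triplet n) :=
  {c | ({(Sum.elim id id c).1, (Sum.elim id id c).2.1, (Sum.elim id id c).2.2} : Set (Fin n)) =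
    {i, j, k}}

lemma pairwiseDisjoint_coinsOn (i j : Fin n) :
    (↑(univ.filter fun k : Fin n ↦ k ≠ i ∧ k ≠ j) : Set (Fin n)).PairwiseDisjoint
      (coinsOn i j) := by
  intro k _ l hl hkl
  refine Set.disjoint_left.2 fun c hck hcl ↦ ?_
  have hmem : l ∈ ({i, j, k} : Set (Fin n)) := by
    rw [← show _ = ({i, j, k} : Set (Fin n)) from hck,
      show _ = ({i, j, l} : Set (Fin n)) from hcl]
    simp
  simp only [Finset.coe_filter, Finset.mem_univ, true_and, Set.mem_ofPred_eq] at hl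
  simp only [Set.mem_insert_iff, Set.mem_singleton_iff] at hmem
  tauto

lemma pair_min_max (a b : Fin n) : ({min a b, max a b} : Set (Fin n)) = {a, b} := by
  rcases le_total a b with h | h <;> simp [h, Set.pair_comm]

lemma inl_pairKey_mem_coinsOn (a b c : Fin n) : .inl (pairKey (a, b, c)) ∈ coinsOn a b c := by
  have := congrArg (insert c) (pair_min_max a b)
  simpa [coinsOn, pairKey, Set.insert_comm c, Set.pair_comm c] using this

lemma inr_flipKey_mem_coinsOn (a b c : Fin n) : .inr (flipKey (a, b, c)) ∈ coinsOn a b c := by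
  simp [coinsOn, flipKey, pair_min_max]

lemma coinsOn_swap_left (a b c : Fin n) : coinsOn b a c = coinsOn a b c := by
  simp only [coinsOn, Set.insert_comm b a]

lemma coinsOn_swap_right (a b c : Fin n) : coinsOn a c b = coinsOn a b c := by
  simp only [coinsOn, Set.pair_comm c b]

lemma dependsOn_noisyContribution (H : HTree n) (i j k : Fin n) :
    DependsOn (noisyContribution H i j k) (coinsOn i j k) := by
  intro x y hxy
  simp only [noisyContribution]
  rw [hxy _ (inl_pairKey_mem_coinsOn i j k), hxy _ (inr_flipKey_mem_coinsOn i j k),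
    hxy _ (coinsOn_swap_right i j k ▸ inl_pairKey_mem_coinsOn i k j),
    hxy _ (coinsOn_swap_left i j k ▸ inr_flipKey_mem_coinsOn j i k),
    hxy _ (coinsOn_swap_left i j k ▸ coinsOn_swap_right j i k ▸ inl_pairKey_mem_coinsOn j k i)]

lemma noisyContribution_sq_le (H : HTree n) (i j k : Fin n) :
    ∃ t : Triplet n, ∀ ω, noisyContribution H i j k ω ^ 2 ≤ 4 * headsIndicator (ω (.inl t)) := by
  rcases inducedIndicator_cases H i j k with ⟨h1, h2, h3⟩ | ⟨h1, h2, h3⟩ | ⟨h1, h2, h3⟩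
  · refine ⟨pairKey (i, j, k), fun ω ↦ ?_⟩
    rcases h3 with h3 | h3 <;> simp only [noisyContribution, h1, h2, h3, headsIndicator] <;>
      split_ifs <;> norm_num
  · refine ⟨pairKey (i, k, j), fun ω ↦ ?_⟩
    simp only [noisyContribution, h1, h2, h3, headsIndicator]
    split_ifs <;> norm_num
  · refine ⟨pairKey (j, k, i), fun ω ↦ ?_⟩
    simp only [noisyContribution, h1, h2, h3, headsIndicator]
    split_ifs <;> norm_num

variable {p δ : ℝ}

lemma isProbabilityMeasure_sumElim_bern (hp0 : 0 ≤ p) (hp1 : p ≤ 1) (hδ0 : 0 ≤ δ) (hδ1 : δ ≤ 1)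
    (c : Triplet n ⊕ Triplet n) :
    IsProbabilityMeasure
      (Sum.elim (fun _ : Triplet n ↦ bern p) (fun _ : Triplet n ↦ bern δ) c) := by
  cases c
  exacts [isProbabilityMeasure_bern hp0 hp1, isProbabilityMeasure_bern hδ0 hδ1]

lemma integral_comp_eval_noisyMeasure (hp0 : 0 ≤ p) (hp1 : p ≤ 1) (hδ0 : 0 ≤ δ) (hδ1 : δ ≤ 1)
    (c : Triplet n ⊕ Triplet n) (f : Bool → ℝ) :
    ∫ ω, f (ω c) ∂(noisyMeasure n p δ) =
      ∫ b, f b ∂(Sum.elim (fun _ : Triplet n ↦ bern p) (fun _ : Triplet n ↦ bern δ) c) := by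
  have := isProbabilityMeasure_sumElim_bern (n := n) hp0 hp1 hδ0 hδ1
  rw [noisyMeasure, ← (measurePreserving_eval (fun c ↦ Sum.elim (fun _ : Triplet n ↦ bern p)
    (fun _ : Triplet n ↦ bern δ) c) c).map_eq, integral_map (measurable_pi_apply c).aemeasurable
      (Measurable.of_discrete (f := f)).aestronglyMeasurable]

lemma integral_sample_noisyMeasure (hp0 : 0 ≤ p) (hp1 : p ≤ 1) (hδ0 : 0 ≤ δ) (hδ1 : δ ≤ 1)
    (t : Triplet n) : ∫ ω, headsIndicator (ω (.inl t)) ∂(noisyMeasure n p δ) = p := by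
  rw [integral_comp_eval_noisyMeasure hp0 hp1 hδ0 hδ1]
  simp [integral_bern hp0 hp1, headsIndicator]

lemma integral_flip_mul_sample (hp0 : 0 ≤ p) (hp1 : p ≤ 1) (hδ0 : 0 ≤ δ) (hδ1 : δ ≤ 1)
    (t u : Triplet n) :
    ∫ ω, (1 - 2 * headsIndicator (ω (.inr u))) * headsIndicator (ω (.inl t))
      ∂(noisyMeasure n p δ) = (1 - 2 * δ) * p := by
  have := isProbabilityMeasure_sumElim_bern (n := n) hp0 hp1 hδ0 hδ1
  have hind : IndepFun (fun ω ↦ 1 - 2 * headsIndicator (ω (.inr u)))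
      (fun ω ↦ headsIndicator (ω (.inl t))) (noisyMeasure n p δ) :=
    indepFun_of_dependsOn (S := {.inr u}) (T := {.inl t}) (by simp)
      (fun x y h ↦ by simp [h _ rfl]) (fun x y h ↦ by simp [h _ rfl])
  rw [hind.integral_fun_mul_eq_mul_integral Measurable.of_discrete.aestronglyMeasurable
      Measurable.of_discrete.aestronglyMeasurable,
    integral_sample_noisyMeasure hp0 hp1 hδ0 hδ1,
    integral_comp_eval_noisyMeasure hp0 hp1 hδ0 hδ1 _ fun b ↦ 1 - 2 * headsIndicator b]
  congr 1
  simp only [Sum.elim_inr, integral_bern hδ0 hδ1, headsIndicator]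
  norm_num
  ring

lemma integral_noisyContribution (hp0 : 0 ≤ p) (hp1 : p ≤ 1) (hδ0 : 0 ≤ δ) (hδ1 : δ ≤ 1)
    (H : HTree n) (i j k : Fin n) :
    ∫ ω, noisyContribution H i j k ω ∂(noisyMeasure n p δ) =
      (1 - 2 * δ) * p * (2 * inducedIndicator H (i, j, k) - inducedIndicator H (i, k, j) -
          inducedIndicator H (j, k, i)) := by
  have := isProbabilityMeasure_sumElim_bern (n := n) hp0 hp1 hδ0 hδ1
  have : IsProbabilityMeasure (noisyMeasure n p δ) := by unfold noisyMeasure; infer_instance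
  have key (a b : ℝ) (t u v : Triplet n) :
      ∫ ω, (1 - 2 * headsIndicator (ω (.inr u))) * (a * headsIndicator (ω (.inl t)) -
        b * headsIndicator (ω (.inl v))) ∂(noisyMeasure n p δ) = (1 - 2 * δ) * p * (a - b) := by
    simp_rw [mul_sub, mul_left_comm _ a, mul_left_comm _ b]
    rw [integral_sub .of_finite .of_finite, integral_const_mul, integral_const_mul,
      integral_flip_mul_sample hp0 hp1 hδ0 hδ1, integral_flip_mul_sample hp0 hp1 hδ0 hδ1]
    ring
  simp only [noisyContribution]
  rw [integral_add .of_finite .of_finite, key, key]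
  ring

lemma integral_sAddS3_noisySampledT (hp0 : 0 ≤ p) (hp1 : p ≤ 1) (hδ0 : 0 ≤ δ) (hδ1 : δ ≤ 1)
    (H : HTree n) (i j : Fin n) :
    ∫ ω, (sAddS3 (noisySampledT H ω) i j : ℝ) ∂(noisyMeasure n p δ) =
      (1 - 2 * δ) * p * (sAddS3 (inducedTriplets H) i j : ℝ) := by
  have := isProbabilityMeasure_sumElim_bern (n := n) hp0 hp1 hδ0 hδ1
  have : IsProbabilityMeasure (noisyMeasure n p δ) := by unfold noisyMeasure; infer_instance
  simp_rw [sAddS3_noisySampledT]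
  rw [integral_finsetSum _ fun _ _ ↦ .of_finite, sAddS3_inducedTriplets, Finset.mul_sum]
  exact Finset.sum_congr rfl fun k _ ↦ integral_noisyContribution hp0 hp1 hδ0 hδ1 H i j k

/-- One-sided deviation bound; `σ = 1` is the upper tail and `σ = -1` the lower tail. -/
lemma measureReal_sAddS3_deviation_le (hp0 : 0 < p) (hp1 : p ≤ 1) (hδ0 : 0 ≤ δ) (hδ1 : δ ≤ 1)
    (H : HTree n) (i j : Fin n) {σ L : ℝ} (hσ : |σ| = 1) (hL0 : 0 < L) (hL : L ≤ p * n) :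
    (noisyMeasure n p δ).real {ω | 4 * Real.sqrt (L * (p * n)) ≤
      σ * ((sAddS3 (noisySampledT H ω) i j : ℝ) -
        (1 - 2 * δ) * p * (sAddS3 (inducedTriplets H) i j : ℝ))} ≤ Real.exp (-L) := by
  have := isProbabilityMeasure_sumElim_bern (n := n) hp0.le hp1 hδ0 hδ1
  have : IsProbabilityMeasure (noisyMeasure n p δ) := by unfold noisyMeasure; infer_instance
  have hq : 0 < p * n := hL0.trans_le hL
  have hsq (k : Fin n) (ω) : (σ * noisyContribution H i j k ω) ^ 2 =
      noisyContribution H i j k ω ^ 2 := by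
    rw [mul_pow, ← sq_abs σ, hσ, one_pow, one_mul]
  set s : Finset (Fin n) := univ.filter fun k : Fin n ↦ k ≠ i ∧ k ≠ j with hs
  set t : ℝ := Real.sqrt L / Real.sqrt (p * n) / 2 with ht
  have hratio : Real.sqrt L / Real.sqrt (p * n) ≤ 1 :=
    div_le_one_of_le₀ (Real.sqrt_le_sqrt hL) (Real.sqrt_nonneg _)
  have h := measureReal_sum_ge_le (b := 2) (v := 4 * p) (t := t)
    (μ := Sum.elim (fun _ : Triplet n ↦ bern p) (fun _ : Triplet n ↦ bern δ))
    (X := fun k ω ↦ σ * noisyContribution H i j k ω) (pairwiseDisjoint_coinsOn i j)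
    (fun k _ x y hxy ↦ by simp only [dependsOn_noisyContribution H i j k hxy])
    (fun k _ ω ↦ by
      obtain ⟨u, hu⟩ := noisyContribution_sq_le H i j k
      refine abs_le_of_sq_le_sq ?_ (by norm_num)
      rw [hsq]
      refine (hu ω).trans ?_
      unfold headsIndicator
      split_ifs <;> norm_num)
    (fun k _ ↦ by
      obtain ⟨u, hu⟩ := noisyContribution_sq_le H i j k
      simp_rw [hsq]
      change ∫ ω, noisyContribution H i j k ω ^ 2 ∂(noisyMeasure n p δ) ≤ 4 * p
      refine (integral_mono .of_finite .of_finite hu).trans_eq ?_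
      rw [integral_const_mul, integral_sample_noisyMeasure hp0.le hp1 hδ0 hδ1])
    (by positivity) (by rw [ht]; linarith) (4 * Real.sqrt (L * (p * n)))
  change (noisyMeasure n p δ).real {ω | ∑ k ∈ s, ∫ ω', σ * noisyContribution H i j k ω'
    ∂(noisyMeasure n p δ) + _ ≤ _} ≤ _ at h
  simp_rw [integral_const_mul, integral_noisyContribution hp0.le hp1 hδ0 hδ1, ← Finset.mul_sum]
    at h
  simp_rw [hs, ← sAddS3_inducedTriplets, ← sAddS3_noisySampledT] at h
  simp_rw [mul_sub, le_sub_iff_add_le']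
  refine h.trans (Real.exp_le_exp.2 ?_)
  have hcard : (s.card : ℝ) ≤ n := by
    exact_mod_cast (Finset.card_le_univ s).trans_eq (Fintype.card_fin n)
  have h1 : t * (4 * Real.sqrt (L * (p * n))) = 2 * L := by
    rw [ht, Real.sqrt_mul hL0.le]
    have := (Real.sqrt_pos.2 hq).ne'
    field_simp
    rw [Real.sq_sqrt hL0.le]
    ring
  have h2 : t ^ 2 * (n * (4 * p)) = L := by
    rw [ht, div_pow, div_pow, Real.sq_sqrt hL0.le, Real.sq_sqrt hq.le]
    field_simp
    have : (n : ℝ) ≠ 0 := by rintro h; simp [h] at hq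
    field_simp
    ring
  have h3 : t ^ 2 * (s.card * (4 * p)) ≤ t ^ 2 * (n * (4 * p)) := by gcongr
  linarith

end NoisyModel

/-- In the noisy sampling model, `E[s_{ij}] = (1−2δ)·p·s_{0ij}` for every `i<j`;
moreover, if `p > (α+2)·log n / n`, then with probability `≥ 1 − n^{−α}`,
`max_{i<j} |s_{ij} − (1−2δ)·p·s_{0ij}| < 4√((α+2)·p·n·log n)`. -/
theorem noisy_AddS3_expectation_and_concentration {n : ℕ}
    (H0 : HTree n) (hH0 : IsHierarchy H0)
    (p δ : ℝ) (hp0 : 0 < p) (hp1 : p ≤ 1) (hδ0 : 0 < δ) (hδ1 : δ < 1 / 2) :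
    (∀ i j : Fin n, i < j →
      (∫ ω, ((sAddS3 (noisySampledT H0 ω) i j : ℝ)) ∂(noisyMeasure n p δ)) =
        (1 - 2 * δ) * p * (sAddS3 (inducedTriplets H0) i j : ℝ)) ∧
    (∀ α : ℝ, 0 < α → p > (α + 2) * Real.log n / n →
      ENNReal.ofReal (1 - (n : ℝ) ^ (-α)) ≤
        noisyMeasure n p δ {ω | ∀ i j : Fin n, i < j →
          |((sAddS3 (noisySampledT H0 ω) i j : ℝ)) -
              (1 - 2 * δ) * p * (sAddS3 (inducedTriplets H0) i j : ℝ)| <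
            4 * Real.sqrt ((α + 2) * p * (n : ℝ) * Real.log n)}) := by
  have hδ1' : δ ≤ 1 := by linarith
  have := isProbabilityMeasure_sumElim_bern (n := n) hp0.le hp1 hδ0.le hδ1'
  have : IsProbabilityMeasure (noisyMeasure n p δ) := by unfold noisyMeasure; infer_instance
  refine ⟨fun i j _ ↦ integral_sAddS3_noisySampledT hp0.le hp1 hδ0.le hδ1' H0 i j,
    fun α hα hpα ↦ ?_⟩
  rcases lt_or_ge n 2 with hn | hn
  · have huniv : {ω | ∀ i j : Fin n, i < j →
          |((sAddS3 (noisySampledT H0 ω) i j : ℝ)) -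
              (1 - 2 * δ) * p * (sAddS3 (inducedTriplets H0) i j : ℝ)| <
            4 * Real.sqrt ((α + 2) * p * (n : ℝ) * Real.log n)} = Set.univ :=
      Set.eq_univ_of_forall fun ω i j hij ↦ by omega
    rw [huniv, measure_univ, ENNReal.ofReal_le_one]
    linarith [Real.rpow_nonneg (Nat.cast_nonneg (α := ℝ) n) (-α)]
  have hn0 : (0 : ℝ) < n := by positivity
  have hL0 : 0 < (α + 2) * Real.log n :=
    mul_pos (by linarith) (Real.log_pos (by exact_mod_cast hn))
  have hL : (α + 2) * Real.log n ≤ p * n := ((div_lt_iff₀ hn0).1 hpα).le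
  set G := {ω | ∀ i j : Fin n, i < j →
    |((sAddS3 (noisySampledT H0 ω) i j : ℝ)) -
        (1 - 2 * δ) * p * (sAddS3 (inducedTriplets H0) i j : ℝ)| <
      4 * Real.sqrt ((α + 2) * p * (n : ℝ) * Real.log n)} with hG
  let B (q : Fin n × Fin n) : Set ((Triplet n ⊕ Triplet n) → Bool) :=
    {ω | 4 * Real.sqrt ((α + 2) * Real.log n * (p * n)) ≤ (if q.1 < q.2 then 1 else -1) *
      ((sAddS3 (noisySampledT H0 ω) q.1 q.2 : ℝ) -
        (1 - 2 * δ) * p * (sAddS3 (inducedTriplets H0) q.1 q.2 : ℝ))}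
  have hcover : Gᶜ ⊆ ⋃ q, B q := by
    intro ω hω
    simp only [hG, Set.mem_compl_iff, Set.mem_ofPred_eq, not_forall, not_lt] at hω
    obtain ⟨i, j, hij, h⟩ := hω
    rw [show (α + 2) * p * (n : ℝ) * Real.log n = (α + 2) * Real.log n * (p * n) by ring] at h
    rcases le_abs.1 h with h | h
    · exact Set.mem_iUnion.2 ⟨(i, j), by simpa [B, hij] using h⟩
    · refine Set.mem_iUnion.2 ⟨(j, i), ?_⟩
      simpa [B, hij.not_gt, sAddS3_comm _ j i] using h
  have hbad : (noisyMeasure n p δ).real Gᶜ ≤ (n : ℝ) ^ (-α) := by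
    calc (noisyMeasure n p δ).real Gᶜ ≤ ∑ q, (noisyMeasure n p δ).real (B q) :=
          (measureReal_mono hcover).trans (measureReal_iUnion_fintype_le B)
      _ ≤ ∑ _q : Fin n × Fin n, Real.exp (-((α + 2) * Real.log n)) :=
          Finset.sum_le_sum fun q _ ↦ measureReal_sAddS3_deviation_le hp0 hp1 hδ0.le hδ1' H0
            q.1 q.2 (by split_ifs <;> simp) hL0 hL
      _ = (n : ℝ) ^ (2 : ℝ) * (n : ℝ) ^ (-(α + 2)) := by
          rw [Real.rpow_def_of_pos hn0 (-(α + 2)), Real.rpow_two]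
          simp only [Finset.sum_const, Finset.card_univ, Fintype.card_prod, Fintype.card_fin,
            nsmul_eq_mul]
          push_cast
          ring_nf
      _ = (n : ℝ) ^ (-α) := by
          rw [← Real.rpow_add hn0]
          ring_nf
  have hcompl := probReal_compl_eq_one_sub (μ := noisyMeasure n p δ) (s := G)
    (Set.toFinite G).measurableSet
  rw [← ofReal_measureReal]
  exact ENNReal.ofReal_le_ofReal (by linarith)

end CompHC
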